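/- Let n ≥ 1, t ≥ 1, let w = (w₁,…,w_n) be a probability vector, let i^(1),…,i^(t) be i.i.d. samples from the categorical distribution on {1,…,n} with parameter w, let c_i = #{τ ≤ t : i^(τ) = i}, and let G₁,…,G_n ≥ 0. Then, assuming w_i > 0 for all i: Σ_{i=1}^n w_i G_i E[ | w_i(t+1)/(c_i+1) − 1 | ] ≤ (3/(2√(t+1))) Σ_{i=1}^n √(w_i) G_i + (1/(t+1)) Σ_{i=1}^n G_i. -/

import Mathlib

/-- `c_i`: the number of time steps `τ ≤ t` at which user `i` was sampled, given the
history `h = (i^{(1)}, …, i^{(t)})`. -/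
def usercount {n t : ℕ} (h : Fin t → Fin n) (i : Fin n) : ℕ :=
  (Finset.univ.filter (fun τ => h τ = i)).card

/-- Expectation of `F (usercount h i)` for `t` independent samples `h` with weights `w`. -/
noncomputable def countExpectation {n : ℕ} (w : Fin n → ℝ) (i : Fin n) (t : ℕ) (F : ℕ → ℝ) : ℝ :=
  ∑ h : Fin t → Fin n, (∏ τ, w (h τ)) * F (usercount h i)

theorem usercount_cons {n t : ℕ} (x : Fin n) (h : Fin t → Fin n) (i : Fin n) :
    usercount (Fin.cons x h : Fin (t + 1) → Fin n) i
      = (if x = i then 1 else 0) + usercount h i := by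
  simp only [usercount, Finset.card_filter, Fin.sum_univ_succ, Fin.cons_zero, Fin.cons_succ]

namespace countExpectation

variable {n : ℕ} {w : Fin n → ℝ} {i : Fin n} {t : ℕ}

theorem zero (F : ℕ → ℝ) : countExpectation w i 0 F = F 0 := by
  simp [countExpectation, usercount]

theorem add (F H : ℕ → ℝ) :
    countExpectation w i t (fun k => F k + H k)
      = countExpectation w i t F + countExpectation w i t H := by
  simp [countExpectation, mul_add, Finset.sum_add_distrib]

theorem const_mul (a : ℝ) (F : ℕ → ℝ) :
    countExpectation w i t (fun k => a * F k) = a * countExpectation w i t F := by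
  simp only [countExpectation, Finset.mul_sum]
  exact Finset.sum_congr rfl fun _ _ => by ring

theorem mono (hw : ∀ j, 0 ≤ w j) {F H : ℕ → ℝ} (hFH : ∀ k, F k ≤ H k) :
    countExpectation w i t F ≤ countExpectation w i t H :=
  Finset.sum_le_sum fun h _ =>
    mul_le_mul_of_nonneg_left (hFH _) (Finset.prod_nonneg fun τ _ => hw (h τ))

theorem succ (hw : ∑ j, w j = 1) (F : ℕ → ℝ) :
    countExpectation w i (t + 1) F
      = w i * countExpectation w i t (fun k => F (k + 1))
        + (1 - w i) * countExpectation w i t F := by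
  have hcons : countExpectation w i (t + 1) F = ∑ x, w x *
      countExpectation w i t (fun k => F ((if x = i then 1 else 0) + k)) := by
    unfold countExpectation
    rw [← (Fin.consEquiv fun _ : Fin (t + 1) => Fin n).sum_comp, Fintype.sum_prod_type]
    refine Finset.sum_congr rfl fun x _ => ?_
    rw [Finset.mul_sum]
    refine Finset.sum_congr rfl fun h _ => ?_
    change (∏ τ, w ((Fin.cons x h : Fin (t + 1) → Fin n) τ)) *
      F (usercount (Fin.cons x h : Fin (t + 1) → Fin n) i) = _
    simp only [usercount_cons, Fin.prod_univ_succ, Fin.cons_zero, Fin.cons_succ]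
    ring
  rw [hcons, ← Finset.add_sum_erase _ _ (Finset.mem_univ i), ← hw,
    ← Finset.add_sum_erase _ w (Finset.mem_univ i), add_sub_cancel_left, Finset.sum_mul]
  congr 1
  · simp [add_comm]
  · refine Finset.sum_congr rfl fun x hx => ?_
    simp [Finset.ne_of_mem_erase hx]

theorem const (hw : ∑ j, w j = 1) (a : ℝ) : countExpectation w i t (fun _ => a) = a := by
  induction t with
  | zero => exact zero _
  | succ t ih => rw [succ hw, ih]; ring

/-- Size-biasing identity for the binomial distribution. -/
theorem natCast_mul (hw : ∑ j, w j = 1) (F : ℕ → ℝ) :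
    countExpectation w i (t + 1) (fun k => k * F k)
      = (t + 1) * w i * countExpectation w i t (fun k => F (k + 1)) := by
  induction t generalizing F with
  | zero => simp [succ hw, zero]
  | succ t ih =>
    have hsplit : (fun k : ℕ => ((k + 1 : ℕ) : ℝ) * F (k + 1))
        = fun k : ℕ => k * F (k + 1) + F (k + 1) := by
      funext k; push_cast; ring
    rw [succ hw, hsplit, add, ih F, ih (fun k => F (k + 1)), succ hw (fun k => F (k + 1))]
    push_cast
    ring

theorem natCast (hw : ∑ j, w j = 1) :
    countExpectation w i t (fun k => (k : ℝ)) = t * w i := by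
  cases t with
  | zero => simp [zero]
  | succ t =>
    have h := natCast_mul (i := i) (t := t) hw (fun _ => 1)
    simp only [mul_one, const hw] at h
    rw [h]; push_cast; ring

theorem sq_deviation (hw : ∑ j, w j = 1) :
    countExpectation w i (t + 1) (fun k => ((t + 1) * w i - k) ^ 2)
      = (t + 1) * w i * (1 - w i) := by
  have hsplit : (fun k : ℕ => ((t + 1) * w i - (k : ℝ)) ^ 2)
      = fun k : ℕ => k * (k : ℝ) + ((-2 * ((t + 1) * w i)) * k + ((t + 1) * w i) ^ 2) := by
    funext k; ring
  rw [hsplit, add, add, const_mul, const hw, natCast hw, natCast_mul hw (fun k => (k : ℝ))]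
  push_cast
  rw [add, const hw, natCast hw]
  ring

theorem abs_deviation_le (hw0 : ∀ j, 0 ≤ w j) (hw : ∑ j, w j = 1) (hi : 0 < w i) :
    countExpectation w i (t + 1) (fun k => |(t + 1) * w i - k|) ≤ √((t + 1) * w i) := by
  set s := √((t + 1) * w i) with hs
  have hpos : 0 < s := Real.sqrt_pos.2 (by positivity)
  have hsq : s ^ 2 = (t + 1) * w i := Real.sq_sqrt (by positivity)
  have hle := mono (i := i) (t := t + 1) hw0
    (F := fun k => (2 * s) * |(t + 1) * w i - k|)
    (H := fun k => ((t + 1) * w i - k) ^ 2 + s ^ 2) fun k => by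
      nlinarith [sq_nonneg (|(t + 1) * w i - (k : ℝ)| - s), sq_abs ((t + 1) * w i - (k : ℝ))]
  rw [const_mul, add, const hw, sq_deviation hw, hsq] at hle
  rw [← mul_le_mul_iff_right₀ (by positivity : 0 < 2 * s)]
  nlinarith [mul_nonneg (sq_nonneg s) hi.le]

theorem weighted_stepsize_le (hw0 : ∀ j, 0 ≤ w j) (hw : ∑ j, w j = 1) (hi : 0 < w i) :
    w i * countExpectation w i t (fun k => |w i * ((t : ℝ) + 1) / ((k : ℝ) + 1) - 1|)
      ≤ √(w i) / √((t : ℝ) + 1) := by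
  have hbias := natCast_mul (i := i) (t := t) hw (fun k => |w i * ((t : ℝ) + 1) / k - 1|)
  push_cast at hbias
  have hle := (mono (i := i) (t := t + 1) hw0
    (F := fun k => k * |w i * ((t : ℝ) + 1) / k - 1|)
    (H := fun k => |(t + 1) * w i - k|) fun k => by
      rcases Nat.eq_zero_or_pos k with rfl | hk
      · simpa using abs_nonneg (((t : ℝ) + 1) * w i)
      · have hk' : (0 : ℝ) < k := by exact_mod_cast hk
        refine le_of_eq ?_
        nth_rewrite 1 [← abs_of_pos hk']
        rw [← abs_mul]
        congr 1
        field_simp).trans (abs_deviation_le hw0 hw hi)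
  rw [hbias, Real.sqrt_mul (by positivity)] at hle
  have hN : 0 < √((t : ℝ) + 1) := Real.sqrt_pos.2 (by positivity)
  have hNsq : √((t : ℝ) + 1) * √((t : ℝ) + 1) = t + 1 := Real.mul_self_sqrt (by positivity)
  rw [le_div_iff₀ hN]
  refine le_of_mul_le_mul_left ?_ hN
  calc _ = √((t : ℝ) + 1) * √((t : ℝ) + 1) * (w i *
        countExpectation w i t (fun k => |w i * ((t : ℝ) + 1) / ((k : ℝ) + 1) - 1|)) := by ring
    _ ≤ _ := by rw [hNsq, ← mul_assoc]; exact hle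

end countExpectation

/-- Lemma 3 of the paper: with `i^{(1)},…,i^{(t)}` i.i.d. categorical with parameter
`w` (histories `h : Fin t → Fin n`, expectations written as
`∑ h, (∏ τ, w (h τ)) * F h`), and `G_i ≥ 0`,
`Σ_i w_i G_i E[|w_i(t+1)/(c_i+1) - 1|] ≤ (3/(2√(t+1))) Σ_i √(w_i) G_i + (1/(t+1)) Σ_i G_i`. -/
theorem weighted_stepsize_deviation
    (n t : ℕ) (hn : 1 ≤ n) (ht : 1 ≤ t)
    (w : Fin n → ℝ) (hw0 : ∀ i, 0 ≤ w i) (hw1 : ∑ i, w i = 1)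
    (hwpos : ∀ i, 0 < w i)
    (G : Fin n → ℝ) (hG : ∀ i, 0 ≤ G i) :
    ∑ i, w i * G i *
      (∑ h : Fin t → Fin n, (∏ τ, w (h τ)) *
        |w i * ((t : ℝ) + 1) / ((usercount h i : ℝ) + 1) - 1|)
      ≤ (3 / (2 * Real.sqrt ((t : ℝ) + 1))) * ∑ i, Real.sqrt (w i) * G i
        + (1 / ((t : ℝ) + 1)) * ∑ i, G i := by
  have hsum : 0 ≤ (1 / ((t : ℝ) + 1)) * ∑ i, G i :=
    mul_nonneg (by positivity) (Finset.sum_nonneg fun i _ => hG i)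
  refine le_add_of_le_of_nonneg ?_ hsum
  rw [Finset.mul_sum]
  refine Finset.sum_le_sum fun i _ => ?_
  have hstep := mul_le_mul_of_nonneg_right
    (countExpectation.weighted_stepsize_le (t := t) hw0 hw1 (hwpos i)) (hG i)
  have hnonneg : 0 ≤ √(w i) / √((t : ℝ) + 1) * G i := mul_nonneg (by positivity) (hG i)
  calc _ = w i * countExpectation w i t
        (fun k => |w i * ((t : ℝ) + 1) / ((k : ℝ) + 1) - 1|) * G i := by
        unfold countExpectation; ring
    _ ≤ √(w i) / √((t : ℝ) + 1) * G i := hstep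
    _ ≤ 3 / 2 * (√(w i) / √((t : ℝ) + 1) * G i) := by linarith
    _ = _ := by
        field_simp
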